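/- Suppose ⦀Ā⦀_T < ∞, ⦀𝒮⦀_T < ∞ and √T · ⦀φ⦀_T · ⦀Ā⦀_T · (1 + ⦀𝒮⦀_T) + ⦀𝒮⦀_T < 1. Then for every initial datum x̄₀ ∈ ℝⁿ the forward–backward system (NewRic) admits a unique solution (ξ, η) on [0,T]. -/

import Mathlib

open Matrix Set

noncomputable section

attribute [local instance] Matrix.normedAddCommGroup Matrix.normedSpace

/-- The operator (spectral) norm of a square real matrix. -/
def opN {k : ℕ} (M : Matrix (Fin k) (Fin k) ℝ) : ℝ :=
  ‖Matrix.toEuclideanCLM (𝕜 := ℝ) M‖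

/-- `⦀φ⦀_T = sup_{0≤t≤T} (‖φ(T,t)^* Q_T^{1/2}‖² + ∫_t^T ‖φ(s,t)^* Q_s^{1/2}‖² ds)^{1/2}`,
where `Qh` (resp. `QTh`) is the positive square root of `Q` (resp. `Q_T`). -/
def phiNorm {n : ℕ} (T : ℝ) (φ : ℝ → ℝ → Matrix (Fin n) (Fin n) ℝ)
    (Qh : ℝ → Matrix (Fin n) (Fin n) ℝ) (QTh : Matrix (Fin n) (Fin n) ℝ) : ℝ :=
  ⨆ t : Set.Icc (0:ℝ) T,
    Real.sqrt ((opN ((φ T t.1)ᵀ * QTh))^2 + ∫ s in t.1..T, (opN ((φ s t.1)ᵀ * Qh s))^2)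

/-- `⦀Ā⦀_T = sup_{0<t<T} ‖Ā_t Q_t^{−1/2}‖`. -/
def abarNorm {n : ℕ} (T : ℝ) (Abar Qh : ℝ → Matrix (Fin n) (Fin n) ℝ) : ℝ :=
  ⨆ t : Set.Ioo (0:ℝ) T, opN (Abar t.1 * (Qh t.1)⁻¹)

/-- `⦀𝒮⦀_T = sup_{0<t≤T} ‖Q_t^{−1/2} 𝒮_t Q_t^{−1/2}‖`, the terminal weights being
used at `t = T`. -/
def sNorm {n : ℕ} (T : ℝ) (S Qbar Qh : ℝ → Matrix (Fin n) (Fin n) ℝ)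
    (ST QbarT QTh : Matrix (Fin n) (Fin n) ℝ) : ℝ :=
  max (⨆ t : Set.Ioo (0:ℝ) T,
        opN ((Qh t.1)⁻¹ * (Qbar t.1 * (1 - S t.1)) * (Qh t.1)⁻¹))
      (opN (QTh⁻¹ * (QbarT * (1 - ST)) * QTh⁻¹))

/-- Solution predicate for the forward–backward system (NewRic). -/
def IsNewRicSol (n m : ℕ) (T : ℝ)
    (A Abar S Q Qbar : ℝ → Matrix (Fin n) (Fin n) ℝ)
    (B : ℝ → Matrix (Fin n) (Fin m) ℝ)
    (R : ℝ → Matrix (Fin m) (Fin m) ℝ)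
    (QT QbarT ST : Matrix (Fin n) (Fin n) ℝ)
    (x₀ : Fin n → ℝ) (ξ η : ℝ → Fin n → ℝ) : Prop :=
  (∀ t ∈ Set.Icc (0:ℝ) T, HasDerivWithinAt ξ
      ((A t + Abar t) *ᵥ ξ t - (B t * (R t)⁻¹ * (B t)ᵀ) *ᵥ η t)
      (Set.Icc (0:ℝ) T) t) ∧
  ξ 0 = x₀ ∧
  (∀ t ∈ Set.Icc (0:ℝ) T, HasDerivWithinAt η
      (-((Q t + Qbar t * (1 - S t)) *ᵥ ξ t + (A t)ᵀ *ᵥ η t))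
      (Set.Icc (0:ℝ) T) t) ∧
  η T = (QT + QbarT * (1 - ST)) *ᵥ ξ T


section LinearODE

/-- Coordinatewise truncation to `[-r, r]`. -/
def truncate {ι : Type*} (r : ℝ) (x : ι → ℝ) : ι → ℝ := fun i => max (-r) (min r (x i))

variable {ι : Type*} [Fintype ι]

lemma lipschitzWith_truncate (r : ℝ) :
    LipschitzWith 1 (truncate r : (ι → ℝ) → ι → ℝ) := by
  refine LipschitzWith.of_dist_le_mul fun x y => ?_
  rw [NNReal.coe_one, one_mul, dist_pi_le_iff dist_nonneg]
  intro i
  have h : LipschitzWith 1 fun z : ℝ => max (-r) (min r z) :=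
    (LipschitzWith.id.const_min r).const_max (-r)
  have := h.dist_le_mul (x i) (y i)
  rw [NNReal.coe_one, one_mul] at this
  exact this.trans (dist_le_pi_dist x y i)

lemma norm_truncate_le {r : ℝ} (hr : 0 ≤ r) (x : ι → ℝ) : ‖truncate r x‖ ≤ r := by
  rw [pi_norm_le_iff_of_nonneg hr]
  intro i
  rw [Real.norm_eq_abs, abs_le]
  exact ⟨le_max_left _ _, max_le (by linarith) (min_le_left _ _)⟩

lemma norm_truncate_le_norm {r : ℝ} (hr : 0 ≤ r) (x : ι → ℝ) : ‖truncate r x‖ ≤ ‖x‖ := by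
  have h := (lipschitzWith_truncate (ι := ι) r).dist_le_mul x 0
  have h0 : truncate r (0 : ι → ℝ) = 0 := by
    funext i; simp [truncate, hr]
  simpa [h0] using h

lemma truncate_eq_self {r : ℝ} {x : ι → ℝ} (hx : ‖x‖ ≤ r) : truncate r x = x := by
  funext i
  have := abs_le.1 ((norm_le_pi_norm x i).trans hx)
  simp [truncate, this.1, this.2]

/-- Global existence for linear initial value problems with continuous coefficients. -/
lemma exists_hasDerivWithinAt_linear {a b : ℝ} (hab : a ≤ b)
    {L : ℝ → (ι → ℝ) →L[ℝ] (ι → ℝ)} (hL : ContinuousOn L (Icc a b)) (x₀ : ι → ℝ) :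
    ∃ α : ℝ → ι → ℝ, α a = x₀ ∧
      ∀ t ∈ Icc a b, HasDerivWithinAt α (L t (α t)) (Icc a b) t := by
  obtain ⟨C', hC'⟩ := isCompact_Icc.exists_bound_of_continuousOn hL
  obtain ⟨C, hC0, hC⟩ : ∃ C : ℝ, 0 ≤ C ∧ ∀ t ∈ Icc a b, ‖L t‖ ≤ C :=
    ⟨max C' 0, le_max_right _ _, fun t ht => (hC' t ht).trans (le_max_left _ _)⟩
  set r : ℝ := ‖x₀‖ * Real.exp (C * (b - a)) with hr
  have hr0 : 0 ≤ r := by positivity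
  have hba : 0 ≤ b - a := sub_nonneg.2 hab
  have hpl : IsPicardLindelof (fun t x => L t (truncate r x)) (⟨a, left_mem_Icc.2 hab⟩ : Icc a b)
      x₀ ⟨C * r * (b - a), by positivity⟩ 0 ⟨C * r, by positivity⟩ ⟨C, hC0⟩ := by
    refine ⟨fun t ht => ?_, fun x _ => hL.clm_apply continuousOn_const, fun t ht x _ => ?_, ?_⟩
    · refine LipschitzWith.lipschitzOnWith (LipschitzWith.of_dist_le_mul fun x y => ?_)
      rw [dist_eq_norm, ← map_sub]
      refine ((L t).le_opNorm _).trans ?_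
      refine mul_le_mul (hC t ht) ?_ (norm_nonneg _) hC0
      rw [← dist_eq_norm]
      simpa using (lipschitzWith_truncate r).dist_le_mul x y
    · exact ((L t).le_opNorm _).trans
        (mul_le_mul (hC t ht) (norm_truncate_le hr0 x) (norm_nonneg _) hC0)
    · change C * r * max (b - a) (a - a) ≤ C * r * (b - a) - 0
      rw [sub_self, max_eq_left hba, sub_zero]
  obtain ⟨α, hα0, hα⟩ := hpl.exists_eq_forall_mem_Icc_hasDerivWithinAt₀
  have hα0 : α a = x₀ := hα0
  refine ⟨α, hα0, fun t ht => ?_⟩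
  have hbound := norm_le_gronwallBound_of_norm_deriv_right_le (f := α)
    (f' := fun t => L t (truncate r (α t))) (δ := ‖x₀‖) (K := C) (ε := 0) (a := a) (b := b)
    (fun t ht => (hα t ht).continuousWithinAt)
    (fun t ht => (hα t (Ico_subset_Icc_self ht)).mono_of_mem_nhdsWithin
      (Icc_mem_nhdsGE_of_mem ht))
    (by rw [hα0])
    (fun t ht => by
      rw [add_zero]
      exact ((L t).le_opNorm _).trans (mul_le_mul (hC t (Ico_subset_Icc_self ht))
        (norm_truncate_le_norm hr0 _) (norm_nonneg _) hC0)) t ht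
  rw [gronwallBound_ε0] at hbound
  have hle : ‖α t‖ ≤ r := by
    refine hbound.trans (mul_le_mul_of_nonneg_left ?_ (norm_nonneg _))
    exact Real.exp_le_exp.2 (mul_le_mul_of_nonneg_left (by linarith [ht.2]) hC0)
  simpa only [truncate_eq_self hle] using hα t ht

end LinearODE

section OperatorNorm

variable {k : ℕ}

/-- The Euclidean norm of a coordinate vector. -/
def euclNorm (v : Fin k → ℝ) : ℝ := ‖WithLp.toLp 2 v‖

lemma euclNorm_nonneg (v : Fin k → ℝ) : 0 ≤ euclNorm v := norm_nonneg _

lemma opN_nonneg (M : Matrix (Fin k) (Fin k) ℝ) : 0 ≤ opN M := norm_nonneg _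

lemma euclNorm_sq (v : Fin k → ℝ) : euclNorm v ^ 2 = v ⬝ᵥ v := by
  rw [euclNorm, EuclideanSpace.real_norm_sq_eq]
  simp [dotProduct, sq]

lemma euclNorm_mulVec_le (M : Matrix (Fin k) (Fin k) ℝ) (v : Fin k → ℝ) :
    euclNorm (M *ᵥ v) ≤ opN M * euclNorm v :=
  (toEuclideanCLM (𝕜 := ℝ) M).le_opNorm (WithLp.toLp 2 v)

lemma dotProduct_le_euclNorm_mul (v w : Fin k → ℝ) : v ⬝ᵥ w ≤ euclNorm v * euclNorm w := by
  have h := real_inner_le_norm (WithLp.toLp 2 v) (WithLp.toLp 2 w)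
  rwa [EuclideanSpace.inner_toLp_toLp, dotProduct_comm] at h

lemma neg_dotProduct_le_euclNorm_mul (v w : Fin k → ℝ) :
    -(v ⬝ᵥ w) ≤ euclNorm v * euclNorm w := by
  have h := dotProduct_le_euclNorm_mul v (-w)
  rwa [dotProduct_neg, euclNorm, euclNorm, WithLp.toLp_neg, norm_neg] at h

lemma opN_mul_le (M N : Matrix (Fin k) (Fin k) ℝ) : opN (M * N) ≤ opN M * opN N := by
  rw [opN, map_mul]; exact norm_mul_le _ _

lemma opN_add_le (M N : Matrix (Fin k) (Fin k) ℝ) : opN (M + N) ≤ opN M + opN N := by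
  rw [opN, map_add]; exact norm_add_le _ _

lemma opN_one_le : opN (1 : Matrix (Fin k) (Fin k) ℝ) ≤ 1 := by
  rw [opN, map_one]; exact ContinuousLinearMap.norm_id_le

lemma opN_sq (M : Matrix (Fin k) (Fin k) ℝ) : opN M ^ 2 = opN (M * Mᵀ) := by
  rw [opN, opN, map_mul, ← conjTranspose_eq_transpose_of_trivial, ← star_eq_conjTranspose,
    map_star, sq]
  exact (CStarRing.norm_self_mul_star
    (E := EuclideanSpace ℝ (Fin k) →L[ℝ] EuclideanSpace ℝ (Fin k))).symm

lemma opN_transpose (M : Matrix (Fin k) (Fin k) ℝ) : opN Mᵀ = opN M := by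
  rw [opN, opN, ← conjTranspose_eq_transpose_of_trivial, ← star_eq_conjTranspose,
    map_star]
  exact norm_star (E := EuclideanSpace ℝ (Fin k) →L[ℝ] EuclideanSpace ℝ (Fin k)) _

lemma continuous_toEuclideanCLM :
    Continuous (toEuclideanCLM (n := Fin k) (𝕜 := ℝ)) :=
  LinearMap.continuous_of_finiteDimensional
    ((toEuclideanCLM (n := Fin k) (𝕜 := ℝ)).toAlgEquiv.toLinearMap)

lemma continuous_opN : Continuous (opN : Matrix (Fin k) (Fin k) ℝ → ℝ) :=
  continuous_norm.comp continuous_toEuclideanCLM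

end OperatorNorm

section CauchySchwarz

open MeasureTheory intervalIntegral

/-- The Cauchy–Schwarz inequality for the sum of a point mass and an integral. -/
lemma mul_add_integral_mul_le {a b α β : ℝ} (hab : a ≤ b) {f g : ℝ → ℝ}
    (hf : ContinuousOn f (Icc a b)) (hg : ContinuousOn g (Icc a b)) :
    α * β + ∫ s in a..b, f s * g s ≤
      Real.sqrt (α ^ 2 + ∫ s in a..b, f s ^ 2) * Real.sqrt (β ^ 2 + ∫ s in a..b, g s ^ 2) := by
  have hX : 0 ≤ α ^ 2 + ∫ s in a..b, f s ^ 2 :=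
    add_nonneg (sq_nonneg _) (integral_nonneg hab fun s _ => sq_nonneg _)
  have hi : ∀ {h : ℝ → ℝ}, ContinuousOn h (Icc a b) → IntervalIntegrable h volume a b :=
    fun h => ContinuousOn.intervalIntegrable_of_Icc hab h
  have key : ∀ c : ℝ, 0 ≤ (α ^ 2 + ∫ s in a..b, f s ^ 2) * (c * c)
      + (-2 * (α * β + ∫ s in a..b, f s * g s)) * c + (β ^ 2 + ∫ s in a..b, g s ^ 2) := by
    intro c
    have h1 : 0 ≤ ∫ s in a..b, (c * f s - g s) ^ 2 :=
      integral_nonneg hab fun s _ => sq_nonneg _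
    have h2 : ∫ s in a..b, (c * f s - g s) ^ 2 =
        c ^ 2 * (∫ s in a..b, f s ^ 2) - 2 * c * (∫ s in a..b, f s * g s)
          + ∫ s in a..b, g s ^ 2 := by
      rw [← intervalIntegral.integral_const_mul, ← intervalIntegral.integral_const_mul,
        ← intervalIntegral.integral_sub, ← intervalIntegral.integral_add]
      · exact integral_congr fun s _ => by ring
      · exact (hi ((continuousOn_const.mul (hf.pow 2)))).sub
          (hi (continuousOn_const.mul (hf.mul hg)))
      · exact hi (hg.pow 2)
      · exact hi (continuousOn_const.mul (hf.pow 2))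
      · exact hi (continuousOn_const.mul (hf.mul hg))
    nlinarith [sq_nonneg (c * α - β)]
  have hd := discrim_le_zero key
  rw [← Real.sqrt_mul hX]
  refine Real.le_sqrt_of_sq_le ?_
  rw [discrim] at hd
  nlinarith

end CauchySchwarz

section Calculus

open MeasureTheory intervalIntegral

variable {ι : Type*} [Fintype ι]

lemma HasDerivWithinAt.dotProduct {f g : ℝ → ι → ℝ} {f' g' : ι → ℝ} {s : Set ℝ} {t : ℝ}
    (hf : HasDerivWithinAt f f' s t) (hg : HasDerivWithinAt g g' s t) :
    HasDerivWithinAt (fun τ => f τ ⬝ᵥ g τ) (f' ⬝ᵥ g t + f t ⬝ᵥ g') s t := by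
  have h := HasDerivWithinAt.fun_sum (u := Finset.univ) fun i (_ : i ∈ Finset.univ) =>
    (hasDerivWithinAt_pi.1 hf i).mul (hasDerivWithinAt_pi.1 hg i)
  simpa only [_root_.dotProduct, Finset.sum_add_distrib] using! h

lemma ContinuousOn.dotProduct {f g : ℝ → ι → ℝ} {s : Set ℝ}
    (hf : ContinuousOn f s) (hg : ContinuousOn g s) :
    ContinuousOn (fun τ => f τ ⬝ᵥ g τ) s := by
  rw [continuousOn_iff_continuous_domRestrict] at *
  exact Continuous.dotProduct hf hg

lemma ContinuousOn.matrix_mulVec {κ : Type*} {M : ℝ → Matrix κ ι ℝ} {f : ℝ → ι → ℝ} {s : Set ℝ}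
    (hM : ContinuousOn M s) (hf : ContinuousOn f s) :
    ContinuousOn (fun τ => M τ *ᵥ f τ) s := by
  rw [continuousOn_iff_continuous_domRestrict] at *
  exact Continuous.matrix_mulVec hM hf

lemma ContinuousOn.matrix_mul {κ μ : Type*} {M : ℝ → Matrix κ ι ℝ} {N : ℝ → Matrix ι μ ℝ}
    {s : Set ℝ} (hM : ContinuousOn M s) (hN : ContinuousOn N s) :
    ContinuousOn (fun τ => M τ * N τ) s := by
  rw [continuousOn_iff_continuous_domRestrict] at *
  exact Continuous.matrix_mul hM hN

lemma ContinuousOn.matrix_transpose {κ μ : Type*} {M : ℝ → Matrix κ μ ℝ}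
    {s : Set ℝ} (hM : ContinuousOn M s) : ContinuousOn (fun τ => (M τ)ᵀ) s := by
  rw [continuousOn_iff_continuous_domRestrict] at *
  exact Continuous.matrix_transpose hM

lemma ContinuousOn.matrix_inv [DecidableEq ι] {M : ℝ → Matrix ι ι ℝ}
    {s : Set ℝ} (hM : ContinuousOn M s) (h : ∀ t ∈ s, (M t).det ≠ 0) :
    ContinuousOn (fun τ => (M τ)⁻¹) s := by
  simp only [Matrix.inv_def, Ring.inverse_eq_inv']
  rw [continuousOn_iff_continuous_domRestrict] at *
  exact (Continuous.inv₀ (Continuous.matrix_det hM) fun t => h t t.2).smul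
    (Continuous.matrix_adjugate hM)

lemma integral_eq_sub_of_hasDerivWithinAt_Icc {f f' : ℝ → ℝ} {a b t : ℝ}
    (hf : ∀ s ∈ Icc a b, HasDerivWithinAt f (f' s) (Icc a b) s)
    (hf' : ContinuousOn f' (Icc a b)) (ht : t ∈ Icc a b) :
    ∫ s in t..b, f' s = f b - f t := by
  have hsub : Icc t b ⊆ Icc a b := Icc_subset_Icc_left ht.1
  refine integral_eq_sub_of_hasDeriv_right_of_le ht.2
    (fun s hs => (hf s (hsub hs)).continuousWithinAt.mono hsub) (fun s hs => ?_)
    ((hf'.mono hsub).intervalIntegrable_of_Icc ht.2)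
  have hs' : s ∈ Ioo a b := ⟨ht.1.trans_lt hs.1, hs.2⟩
  exact ((hf s (Ioo_subset_Icc_self hs')).hasDerivAt (Icc_mem_nhds hs'.1 hs'.2)).hasDerivWithinAt

end Calculus

section WeightedBounds

variable {k : ℕ} {Q Qh W : Matrix (Fin k) (Fin k) ℝ}

lemma euclNorm_mulVec_sq (hsymm : Qhᵀ = Qh) (hsq : Qh * Qh = Q) (x : Fin k → ℝ) :
    euclNorm (Qh *ᵥ x) ^ 2 = x ⬝ᵥ (Q *ᵥ x) := by
  rw [euclNorm_sq, ← hsq, ← mulVec_mulVec, dotProduct_mulVec x, ← mulVec_transpose, hsymm]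

lemma opN_transpose_mul_sq (hsymm : Qhᵀ = Qh) (hsq : Qh * Qh = Q)
    (Φ : Matrix (Fin k) (Fin k) ℝ) : opN (Φᵀ * Qh) ^ 2 = opN (Φᵀ * Q * Φ) := by
  rw [opN_sq, transpose_mul, transpose_transpose, hsymm, ← hsq]
  simp only [Matrix.mul_assoc]

lemma euclNorm_mulVec_le_of_opN_mul_inv_le (hdet : IsUnit Qh.det)
    {B : Matrix (Fin k) (Fin k) ℝ} {c : ℝ} (hc : opN (B * Qh⁻¹) ≤ c) (x : Fin k → ℝ) :
    euclNorm (B *ᵥ x) ≤ c * euclNorm (Qh *ᵥ x) := by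
  have h : B *ᵥ x = (B * Qh⁻¹) *ᵥ (Qh *ᵥ x) := by
    rw [mulVec_mulVec, Matrix.mul_assoc, Matrix.nonsing_inv_mul _ hdet, Matrix.mul_one]
  rw [h]
  exact (euclNorm_mulVec_le _ _).trans (mul_le_mul_of_nonneg_right hc (euclNorm_nonneg _))

lemma dotProduct_mulVec_add_le (hdet : IsUnit Qh.det) (hsq : Qh * Qh = Q)
    {σ : ℝ} (hσ : opN (Qh⁻¹ * W * Qh⁻¹) ≤ σ)
    (Φ : Matrix (Fin k) (Fin k) ℝ) (v x : Fin k → ℝ) :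
    (Φ *ᵥ v) ⬝ᵥ ((Q + W) *ᵥ x) ≤
      euclNorm v * (1 + σ) * (opN (Φᵀ * Qh) * euclNorm (Qh *ᵥ x)) := by
  have hfac : Q + W = Qh * (1 + Qh⁻¹ * W * Qh⁻¹) * Qh := by
    rw [Matrix.mul_add, Matrix.mul_one, Matrix.add_mul, hsq]
    congr 1
    rw [← Matrix.mul_assoc, ← Matrix.mul_assoc, Matrix.mul_nonsing_inv _ hdet, Matrix.one_mul,
      Matrix.mul_assoc, Matrix.nonsing_inv_mul _ hdet, Matrix.mul_one]
  have h : (Φ *ᵥ v) ⬝ᵥ ((Q + W) *ᵥ x) =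
      v ⬝ᵥ ((Φᵀ * Qh) *ᵥ ((1 + Qh⁻¹ * W * Qh⁻¹) *ᵥ (Qh *ᵥ x))) := by
    rw [hfac, ← vecMul_transpose, ← dotProduct_mulVec]
    simp only [mulVec_mulVec, Matrix.mul_assoc]
  have h1 : opN (1 + Qh⁻¹ * W * Qh⁻¹) ≤ 1 + σ :=
    (opN_add_le _ _).trans (add_le_add opN_one_le hσ)
  rw [h, mul_assoc (euclNorm v)]
  refine (dotProduct_le_euclNorm_mul _ _).trans
    (mul_le_mul_of_nonneg_left ?_ (euclNorm_nonneg _))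
  calc _ ≤ opN (Φᵀ * Qh) * (opN (1 + Qh⁻¹ * W * Qh⁻¹) * euclNorm (Qh *ᵥ x)) :=
        (euclNorm_mulVec_le _ _).trans
          (mul_le_mul_of_nonneg_left (euclNorm_mulVec_le _ _) (opN_nonneg _))
    _ ≤ opN (Φᵀ * Qh) * ((1 + σ) * euclNorm (Qh *ᵥ x)) :=
        mul_le_mul_of_nonneg_left (mul_le_mul_of_nonneg_right h1 (euclNorm_nonneg _))
          (opN_nonneg _)
    _ = _ := by ring

lemma neg_dotProduct_mulVec_le (hsymm : Qhᵀ = Qh) (hdet : IsUnit Qh.det)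
    {σ : ℝ} (hσ : opN (Qh⁻¹ * W * Qh⁻¹) ≤ σ) (x : Fin k → ℝ) :
    -(x ⬝ᵥ (W *ᵥ x)) ≤ σ * euclNorm (Qh *ᵥ x) ^ 2 := by
  have hfac : W = Qh * (Qh⁻¹ * W * Qh⁻¹) * Qh := by
    rw [← Matrix.mul_assoc, ← Matrix.mul_assoc, Matrix.mul_nonsing_inv _ hdet, Matrix.one_mul,
      Matrix.mul_assoc, Matrix.nonsing_inv_mul _ hdet, Matrix.mul_one]
  have h : x ⬝ᵥ (W *ᵥ x) = (Qh *ᵥ x) ⬝ᵥ ((Qh⁻¹ * W * Qh⁻¹) *ᵥ (Qh *ᵥ x)) := by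
    conv_lhs => rw [hfac, ← mulVec_mulVec, ← mulVec_mulVec, dotProduct_mulVec, ← mulVec_transpose,
      hsymm]
  rw [h]
  calc _ ≤ euclNorm (Qh *ᵥ x) * (opN (Qh⁻¹ * W * Qh⁻¹) * euclNorm (Qh *ᵥ x)) :=
        (neg_dotProduct_le_euclNorm_mul _ _).trans
          (mul_le_mul_of_nonneg_left (euclNorm_mulVec_le _ _) (euclNorm_nonneg _))
    _ ≤ euclNorm (Qh *ᵥ x) * (σ * euclNorm (Qh *ᵥ x)) :=
        mul_le_mul_of_nonneg_left (mul_le_mul_of_nonneg_right hσ (euclNorm_nonneg _))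
          (euclNorm_nonneg _)
    _ = _ := by ring

end WeightedBounds

section FundamentalSolution

open MeasureTheory intervalIntegral

variable {n : ℕ} {T : ℝ} {A Q Qh : ℝ → Matrix (Fin n) (Fin n) ℝ}
  {φ : ℝ → ℝ → Matrix (Fin n) (Fin n) ℝ}

lemma exists_opN_fundamental_le (hAc : ContinuousOn A (Icc 0 T))
    (hφ : ∀ s ∈ Icc (0:ℝ) T, φ s s = 1 ∧
      ∀ t ∈ Icc (0:ℝ) T, HasDerivWithinAt (fun τ => φ τ s) (A t * φ t s) (Icc (0:ℝ) T) t) :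
    ∃ C, 0 ≤ C ∧ ∀ s ∈ Icc (0:ℝ) T, ∀ t ∈ Icc s T, opN (φ t s) ≤ C := by
  obtain ⟨K', hK'⟩ := isCompact_Icc.exists_bound_of_continuousOn
    (continuous_opN.comp_continuousOn hAc)
  obtain ⟨K, hK0, hK⟩ : ∃ K : ℝ, 0 ≤ K ∧ ∀ t ∈ Icc 0 T, opN (A t) ≤ K :=
    ⟨max K' 0, le_max_right _ _, fun t ht =>
      ((le_abs_self _).trans (hK' t ht)).trans (le_max_left _ _)⟩
  refine ⟨1 * Real.exp (K * T), by positivity, fun s hs t ht => ?_⟩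
  set ℓ : Matrix (Fin n) (Fin n) ℝ →L[ℝ] (EuclideanSpace ℝ (Fin n) →L[ℝ] EuclideanSpace ℝ (Fin n)) :=
    ⟨(toEuclideanCLM (n := Fin n) (𝕜 := ℝ)).toAlgEquiv.toLinearMap,
      continuous_toEuclideanCLM⟩ with hℓ
  have hℓn : ∀ M, ‖ℓ M‖ = opN M := fun M => rfl
  have hsub : Icc s T ⊆ Icc 0 T := Icc_subset_Icc_left hs.1
  have hd : ∀ τ ∈ Icc 0 T, HasDerivWithinAt (fun τ => ℓ (φ τ s)) (ℓ (A τ * φ τ s)) (Icc 0 T) τ :=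
    fun τ hτ => ℓ.hasFDerivAt.comp_hasDerivWithinAt τ ((hφ s hs).2 τ hτ)
  have h := norm_le_gronwallBound_of_norm_deriv_right_le (f := fun τ => ℓ (φ τ s))
    (f' := fun τ => ℓ (A τ * φ τ s)) (δ := 1) (K := K) (ε := 0) (a := s) (b := T)
    (fun τ hτ => (hd τ (hsub hτ)).continuousWithinAt.mono hsub)
    (fun τ hτ => ((hd τ (hsub (Ico_subset_Icc_self hτ))).mono hsub).mono_of_mem_nhdsWithin
      (Icc_mem_nhdsGE_of_mem hτ))
    (by rw [hℓn, (hφ s hs).1]; exact opN_one_le)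
    (fun τ hτ => by
      rw [add_zero, hℓn, hℓn]
      exact (opN_mul_le _ _).trans (mul_le_mul_of_nonneg_right
        (hK τ (hsub (Ico_subset_Icc_self hτ))) (opN_nonneg _))) t ht
  rw [gronwallBound_ε0, hℓn] at h
  refine h.trans (mul_le_mul_of_nonneg_left (Real.exp_le_exp.2 ?_) zero_le_one)
  exact mul_le_mul_of_nonneg_left (by linarith [ht.2, hs.1]) hK0

lemma continuousOn_opN_fundamental (hQc : ContinuousOn Q (Icc 0 T))
    (hQh : ∀ t ∈ Icc (0:ℝ) T, (Qh t)ᵀ = Qh t ∧ Qh t * Qh t = Q t)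
    (hφ : ∀ s ∈ Icc (0:ℝ) T, φ s s = 1 ∧
      ∀ t ∈ Icc (0:ℝ) T, HasDerivWithinAt (fun τ => φ τ s) (A t * φ t s) (Icc (0:ℝ) T) t)
    {t : ℝ} (ht : t ∈ Icc (0:ℝ) T) :
    ContinuousOn (fun s => opN ((φ s t)ᵀ * Qh s)) (Icc 0 T) := by
  have hc : ContinuousOn (fun s => φ s t) (Icc 0 T) :=
    fun s hs => ((hφ t ht).2 s hs).continuousWithinAt
  have h : ContinuousOn (fun s => Real.sqrt (opN ((φ s t)ᵀ * Q s * φ s t))) (Icc 0 T) :=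
    (continuous_opN.comp_continuousOn
      ((hc.matrix_transpose.matrix_mul hQc).matrix_mul hc)).sqrt
  refine h.congr fun s hs => ?_
  simp only
  rw [← opN_transpose_mul_sq (hQh s hs).1 (hQh s hs).2, Real.sqrt_sq (opN_nonneg _)]

lemma bddAbove_range_phiNorm (hAc : ContinuousOn A (Icc 0 T)) (hQc : ContinuousOn Q (Icc 0 T))
    (hQh : ∀ t ∈ Icc (0:ℝ) T, (Qh t)ᵀ = Qh t ∧ Qh t * Qh t = Q t)
    (QTh : Matrix (Fin n) (Fin n) ℝ)
    (hφ : ∀ s ∈ Icc (0:ℝ) T, φ s s = 1 ∧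
      ∀ t ∈ Icc (0:ℝ) T, HasDerivWithinAt (fun τ => φ τ s) (A t * φ t s) (Icc (0:ℝ) T) t) :
    BddAbove (range fun t : Icc (0:ℝ) T =>
      Real.sqrt ((opN ((φ T t.1)ᵀ * QTh))^2 + ∫ s in t.1..T, (opN ((φ s t.1)ᵀ * Qh s))^2)) := by
  obtain ⟨C, hC0, hC⟩ := exists_opN_fundamental_le hAc hφ
  obtain ⟨K', hK'⟩ := isCompact_Icc.exists_bound_of_continuousOn
    (continuous_opN.comp_continuousOn hQc)
  obtain ⟨K, hK0, hK⟩ : ∃ K : ℝ, 0 ≤ K ∧ ∀ t ∈ Icc 0 T, opN (Q t) ≤ K :=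
    ⟨max K' 0, le_max_right _ _, fun t ht =>
      ((le_abs_self _).trans (hK' t ht)).trans (le_max_left _ _)⟩
  refine ⟨Real.sqrt ((C * opN QTh) ^ 2 + T * (C * K * C)), ?_⟩
  rintro _ ⟨⟨t, ht⟩, rfl⟩
  have hT : T ∈ Icc t T := right_mem_Icc.2 ht.2
  refine Real.sqrt_le_sqrt (add_le_add ?_ ?_)
  · refine pow_le_pow_left₀ (opN_nonneg _) ((opN_mul_le _ _).trans ?_) 2
    rw [opN_transpose]
    exact mul_le_mul_of_nonneg_right (hC t ht T hT) (opN_nonneg _)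
  · have hb : ∫ s in t..T, (opN ((φ s t)ᵀ * Qh s))^2 ≤ ∫ s in t..T, C * K * C := by
      refine integral_mono_on ht.2 ?_ intervalIntegrable_const fun s hs => ?_
      · exact (((continuousOn_opN_fundamental hQc hQh hφ ht).pow 2).mono
          (Icc_subset_Icc_left ht.1)).intervalIntegrable_of_Icc ht.2
      · have hs' : s ∈ Icc 0 T := ⟨ht.1.trans hs.1, hs.2⟩
        rw [opN_transpose_mul_sq (hQh s hs').1 (hQh s hs').2]
        have h1 := hC t ht s hs
        refine (opN_mul_le _ _).trans (mul_le_mul ((opN_mul_le _ _).trans ?_) h1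
          (opN_nonneg _) (by positivity))
        rw [opN_transpose]
        exact mul_le_mul h1 (hK s hs') (opN_nonneg _) hC0
    refine hb.trans ?_
    rw [intervalIntegral.integral_const, smul_eq_mul]
    exact mul_le_mul_of_nonneg_right (by linarith [ht.1]) (by positivity)

end FundamentalSolution

section Uniqueness

open MeasureTheory intervalIntegral

variable {n : ℕ} {T : ℝ} {A Abar Q W M Qh : ℝ → Matrix (Fin n) (Fin n) ℝ}
  {φ : ℝ → ℝ → Matrix (Fin n) (Fin n) ℝ} {QT WT QTh : Matrix (Fin n) (Fin n) ℝ}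
  {ξ η : ℝ → Fin n → ℝ}

/-- Variation of constants for the backward equation, tested against a solution of the
forward equation `ψ' = A ψ`. -/
lemma dotProduct_backward_eq {g ψ : ℝ → Fin n → ℝ} (hg : ContinuousOn g (Icc 0 T))
    (hη : ∀ t ∈ Icc 0 T, HasDerivWithinAt η (-(g t + (A t)ᵀ *ᵥ η t)) (Icc 0 T) t)
    (hψ : ∀ t ∈ Icc 0 T, HasDerivWithinAt ψ (A t *ᵥ ψ t) (Icc 0 T) t)
    {t : ℝ} (ht : t ∈ Icc 0 T) :
    ψ t ⬝ᵥ η t = ψ T ⬝ᵥ η T + ∫ s in t..T, ψ s ⬝ᵥ g s := by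
  have hψc : ContinuousOn ψ (Icc 0 T) := fun s hs => (hψ s hs).continuousWithinAt
  have h := integral_eq_sub_of_hasDerivWithinAt_Icc (f := fun s => ψ s ⬝ᵥ η s)
    (f' := fun s => -(ψ s ⬝ᵥ g s)) (fun s hs => ?_) (hψc.dotProduct hg).neg ht
  · rw [intervalIntegral.integral_neg] at h
    linarith
  · have hd := (hψ s hs).dotProduct (hη s hs)
    have e : A s *ᵥ ψ s ⬝ᵥ η s = ψ s ⬝ᵥ (A s)ᵀ *ᵥ η s := by
      rw [dotProduct_mulVec, vecMul_transpose]
    convert hd using 1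
    rw [e, dotProduct_neg, dotProduct_add]
    ring

/-- The energy identity for the forward–backward system. -/
lemma energy_identity (hAbarc : ContinuousOn Abar (Icc 0 T)) (hQc : ContinuousOn Q (Icc 0 T))
    (hWc : ContinuousOn W (Icc 0 T)) (hMc : ContinuousOn M (Icc 0 T)) (hT : 0 < T)
    (hξ : ∀ t ∈ Icc 0 T,
      HasDerivWithinAt ξ ((A t + Abar t) *ᵥ ξ t - M t *ᵥ η t) (Icc 0 T) t)
    (hη : ∀ t ∈ Icc 0 T,
      HasDerivWithinAt η (-((Q t + W t) *ᵥ ξ t + (A t)ᵀ *ᵥ η t)) (Icc 0 T) t)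
    (hξ0 : ξ 0 = 0) :
    ξ T ⬝ᵥ η T = ∫ t in (0:ℝ)..T, (-(ξ t ⬝ᵥ (Q t *ᵥ ξ t)) - ξ t ⬝ᵥ (W t *ᵥ ξ t)
      + η t ⬝ᵥ (Abar t *ᵥ ξ t) - η t ⬝ᵥ (M t *ᵥ η t)) := by
  have hξc : ContinuousOn ξ (Icc 0 T) := fun s hs => (hξ s hs).continuousWithinAt
  have hηc : ContinuousOn η (Icc 0 T) := fun s hs => (hη s hs).continuousWithinAt
  have h := integral_eq_sub_of_hasDerivWithinAt_Icc (f := fun s => ξ s ⬝ᵥ η s)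
    (f' := fun t => -(ξ t ⬝ᵥ (Q t *ᵥ ξ t)) - ξ t ⬝ᵥ (W t *ᵥ ξ t)
      + η t ⬝ᵥ (Abar t *ᵥ ξ t) - η t ⬝ᵥ (M t *ᵥ η t)) (fun s hs => ?_)
    ((((hξc.dotProduct (hQc.matrix_mulVec hξc)).neg.sub
      (hξc.dotProduct (hWc.matrix_mulVec hξc))).add
      (hηc.dotProduct (hAbarc.matrix_mulVec hξc))).sub
      (hηc.dotProduct (hMc.matrix_mulVec hηc))) (left_mem_Icc.2 hT.le)
  · simp only [h, hξ0, zero_dotProduct, sub_zero]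
  · have hd := (hξ s hs).dotProduct (hη s hs)
    have e : A s *ᵥ ξ s ⬝ᵥ η s = ξ s ⬝ᵥ (A s)ᵀ *ᵥ η s := by
      rw [dotProduct_mulVec, vecMul_transpose]
    convert hd using 1
    rw [add_mulVec, add_mulVec, sub_dotProduct, add_dotProduct, e, dotProduct_neg,
      dotProduct_add, dotProduct_add, dotProduct_comm (Abar s *ᵥ ξ s),
      dotProduct_comm (M s *ᵥ η s)]
    ring

/-- Under the smallness condition, the homogeneous forward–backward system has only the trivial
solution. -/
lemma homogeneous_eq_zero (hT : 0 < T)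
    (hAbarc : ContinuousOn Abar (Icc 0 T)) (hQc : ContinuousOn Q (Icc 0 T))
    (hWc : ContinuousOn W (Icc 0 T)) (hMc : ContinuousOn M (Icc 0 T))
    (hQ : ∀ t ∈ Icc (0:ℝ) T, (Q t).PosDef)
    (hM : ∀ t ∈ Icc (0:ℝ) T, ∀ v, 0 ≤ v ⬝ᵥ (M t *ᵥ v))
    (hQh : ∀ t ∈ Icc (0:ℝ) T, (Qh t)ᵀ = Qh t ∧ Qh t * Qh t = Q t)
    (hQhdet : ∀ t ∈ Icc (0:ℝ) T, IsUnit (Qh t).det)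
    (hQTh : QThᵀ = QTh ∧ QTh * QTh = QT) (hQThdet : IsUnit QTh.det)
    (hφ : ∀ s ∈ Icc (0:ℝ) T, φ s s = 1 ∧
      ∀ t ∈ Icc (0:ℝ) T, HasDerivWithinAt (fun τ => φ τ s) (A t * φ t s) (Icc (0:ℝ) T) t)
    {P a σ : ℝ} (ha0 : 0 ≤ a) (hσ0 : 0 ≤ σ)
    (hP : ∀ t ∈ Icc (0:ℝ) T,
      Real.sqrt ((opN ((φ T t)ᵀ * QTh)) ^ 2 + ∫ s in t..T, (opN ((φ s t)ᵀ * Qh s)) ^ 2) ≤ P)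
    (ha : ∀ t ∈ Ioo (0:ℝ) T, opN (Abar t * (Qh t)⁻¹) ≤ a)
    (hσ : ∀ t ∈ Ioo (0:ℝ) T, opN ((Qh t)⁻¹ * W t * (Qh t)⁻¹) ≤ σ)
    (hσT : opN (QTh⁻¹ * WT * QTh⁻¹) ≤ σ)
    (hcond : Real.sqrt T * P * a * (1 + σ) + σ < 1)
    (hξ : ∀ t ∈ Icc 0 T,
      HasDerivWithinAt ξ ((A t + Abar t) *ᵥ ξ t - M t *ᵥ η t) (Icc 0 T) t)
    (hη : ∀ t ∈ Icc 0 T,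
      HasDerivWithinAt η (-((Q t + W t) *ᵥ ξ t + (A t)ᵀ *ᵥ η t)) (Icc 0 T) t)
    (hξ0 : ξ 0 = 0) (hηT : η T = (QT + WT) *ᵥ ξ T) :
    ∀ t ∈ Icc 0 T, ξ t = 0 ∧ η t = 0 := by
  have hξc : ContinuousOn ξ (Icc 0 T) := fun s hs => (hξ s hs).continuousWithinAt
  have hηc : ContinuousOn η (Icc 0 T) := fun s hs => (hη s hs).continuousWithinAt
  set q : ℝ → ℝ := fun t => euclNorm (Qh t *ᵥ ξ t)
  set qT : ℝ := euclNorm (QTh *ᵥ ξ T)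
  have hq2 : ∀ t ∈ Icc 0 T, q t ^ 2 = ξ t ⬝ᵥ (Q t *ᵥ ξ t) := fun t ht =>
    euclNorm_mulVec_sq (hQh t ht).1 (hQh t ht).2 _
  have hqc : ContinuousOn q (Icc 0 T) :=
    (hξc.dotProduct (hQc.matrix_mulVec hξc)).sqrt.congr fun t ht => by
      simp only
      rw [← hq2 t ht, Real.sqrt_sq (euclNorm_nonneg _)]
  set I : ℝ := ∫ t in (0:ℝ)..T, q t ^ 2
  have hI0 : 0 ≤ I := integral_nonneg hT.le fun s _ => sq_nonneg _
  set N : ℝ := Real.sqrt (qT ^ 2 + I) with hN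
  have hN2 : N ^ 2 = qT ^ 2 + I := Real.sq_sqrt (by positivity)
  have hN0 : 0 ≤ N := Real.sqrt_nonneg _
  have hP0 : 0 ≤ P := (Real.sqrt_nonneg _).trans (hP 0 (left_mem_Icc.2 hT.le))
  have hint : ∀ {f : ℝ → ℝ}, ContinuousOn f (Icc 0 T) → IntervalIntegrable f volume 0 T :=
    fun hf => hf.intervalIntegrable_of_Icc hT.le
  -- the backward component is controlled by the weighted norm of the forward one
  have hηle : ∀ t ∈ Icc 0 T, euclNorm (η t) ≤ (1 + σ) * P * N := by
    intro t ht
    have hsub : Icc t T ⊆ Icc 0 T := Icc_subset_Icc_left ht.1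
    set p : ℝ → ℝ := fun s => opN ((φ s t)ᵀ * Qh s)
    have hpc : ContinuousOn p (Icc t T) := (continuousOn_opN_fundamental hQc hQh hφ ht).mono hsub
    set ψ : ℝ → Fin n → ℝ := fun s => φ s t *ᵥ η t with hψ
    have hψd : ∀ s ∈ Icc 0 T, HasDerivWithinAt ψ (A s *ᵥ ψ s) (Icc 0 T) s := by
      intro s hs
      have h := (hφ t ht).2 s hs
      let ℓ : Matrix (Fin n) (Fin n) ℝ →ₗ[ℝ] (Fin n → ℝ) :=
        (Matrix.mulVecBilin ℝ ℝ).flip (η t)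
      have hℓ := (LinearMap.toContinuousLinearMap ℓ).hasFDerivAt.comp_hasDerivWithinAt s h
      rw [hψ]
      simp only [mulVec_mulVec]
      exact hℓ
    have hgc : ContinuousOn (fun s => (Q s + W s) *ᵥ ξ s) (Icc 0 T) :=
      (hQc.add hWc).matrix_mulVec hξc
    have hψc : ContinuousOn ψ (Icc 0 T) := fun s hs => (hψd s hs).continuousWithinAt
    have hrep := dotProduct_backward_eq hgc hη hψd ht
    have hψt : ψ t = η t := by simp [hψ, (hφ t ht).1]
    rw [hψt, ← euclNorm_sq, hηT] at hrep
    have h1 : ψ T ⬝ᵥ ((QT + WT) *ᵥ ξ T) ≤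
        euclNorm (η t) * (1 + σ) * (opN ((φ T t)ᵀ * QTh) * qT) :=
      dotProduct_mulVec_add_le hQThdet hQTh.2 hσT _ _ _
    have h2 : ∫ s in t..T, ψ s ⬝ᵥ ((Q s + W s) *ᵥ ξ s) ≤
        ∫ s in t..T, euclNorm (η t) * (1 + σ) * (p s * q s) := by
      refine integral_mono_on_of_le_Ioo ht.2
        (((hψc.dotProduct hgc).mono hsub).intervalIntegrable_of_Icc ht.2)
        ((continuousOn_const.mul (hpc.mul (hqc.mono hsub))).intervalIntegrable_of_Icc ht.2)
        fun s hs => ?_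
      have hs' : s ∈ Ioo 0 T := ⟨ht.1.trans_lt hs.1, hs.2⟩
      have hs'' := Ioo_subset_Icc_self hs'
      exact dotProduct_mulVec_add_le (hQhdet s hs'') (hQh s hs'').2 (hσ s hs') _ _ _
    rw [intervalIntegral.integral_const_mul] at h2
    have h3 := mul_add_integral_mul_le (α := opN ((φ T t)ᵀ * QTh)) (β := qT) ht.2 hpc
      (hqc.mono hsub)
    have h4 : ∫ s in t..T, q s ^ 2 ≤ I := by
      refine integral_mono_interval ht.1 ht.2 le_rfl ?_ (hint (hqc.pow 2))
      exact Filter.Eventually.of_forall fun s => sq_nonneg _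
    have h5 := h3.trans (mul_le_mul (hP t ht) (Real.sqrt_le_sqrt (add_le_add_right h4 (qT ^ 2)))
      (Real.sqrt_nonneg _) hP0)
    have h6 : euclNorm (η t) ^ 2 ≤ euclNorm (η t) * ((1 + σ) * P * N) := by
      have := mul_le_mul_of_nonneg_left h5
        (mul_nonneg (euclNorm_nonneg (η t)) (by linarith : 0 ≤ 1 + σ))
      rw [hrep]
      refine (add_le_add h1 h2).trans ?_
      rw [← mul_add]
      refine this.trans (le_of_eq ?_)
      rw [← hN]
      ring
    rcases (euclNorm_nonneg (η t)).eq_or_lt with h0 | h0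
    · rw [← h0]; positivity
    · exact le_of_mul_le_mul_left (by rwa [sq] at h6) h0
  -- energy estimate
  have hen := energy_identity hAbarc hQc hWc hMc hT hξ hη hξ0
  set c : ℝ := (1 + σ) * P * N * a with hc
  have hc0 : 0 ≤ c := by positivity
  have hle : ξ T ⬝ᵥ η T ≤ ∫ t in (0:ℝ)..T, ((σ - 1) * q t ^ 2 + c * q t) := by
    rw [hen]
    refine integral_mono_on_of_le_Ioo hT.le (hint ?_) (hint ?_) fun t ht => ?_
    · exact ((((hξc.dotProduct (hQc.matrix_mulVec hξc)).neg.sub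
        (hξc.dotProduct (hWc.matrix_mulVec hξc))).add
        (hηc.dotProduct (hAbarc.matrix_mulVec hξc))).sub
        (hηc.dotProduct (hMc.matrix_mulVec hηc)))
    · exact (continuousOn_const.mul (hqc.pow 2)).add (continuousOn_const.mul hqc)
    · have ht' := Ioo_subset_Icc_self ht
      have e1 := hq2 t ht'
      have e2 : -(ξ t ⬝ᵥ (W t *ᵥ ξ t)) ≤ σ * q t ^ 2 :=
        neg_dotProduct_mulVec_le (hQh t ht').1 (hQhdet t ht') (hσ t ht) _
      have e3 := hM t ht' (η t)
      have e4 : η t ⬝ᵥ (Abar t *ᵥ ξ t) ≤ c * q t := by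
        calc _ ≤ euclNorm (η t) * euclNorm (Abar t *ᵥ ξ t) := dotProduct_le_euclNorm_mul _ _
          _ ≤ (1 + σ) * P * N * (a * q t) :=
              mul_le_mul (hηle t ht')
                (euclNorm_mulVec_le_of_opN_mul_inv_le (hQhdet t ht') (ha t ht) _)
                (euclNorm_nonneg _) (by positivity)
          _ = _ := by ring
      linarith
  have hi₁ : IntervalIntegrable (fun t => (σ - 1) * q t ^ 2) volume 0 T :=
    hint (continuousOn_const.mul (hqc.pow 2))
  have hi₂ : IntervalIntegrable (fun t => c * q t) volume 0 T :=
    hint (continuousOn_const.mul hqc)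
  rw [intervalIntegral.integral_add hi₁ hi₂, intervalIntegral.integral_const_mul,
    intervalIntegral.integral_const_mul] at hle
  have hJ : ∫ t in (0:ℝ)..T, q t ≤ Real.sqrt T * N := by
    have h := mul_add_integral_mul_le (α := 0) (β := qT) hT.le
      (continuousOn_const (c := (1:ℝ))) hqc
    simpa using h
  have hterm : qT ^ 2 - σ * qT ^ 2 ≤ ξ T ⬝ᵥ η T := by
    have h1 : -(ξ T ⬝ᵥ (WT *ᵥ ξ T)) ≤ σ * qT ^ 2 :=
      neg_dotProduct_mulVec_le hQTh.1 hQThdet hσT _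
    have h2 : qT ^ 2 = ξ T ⬝ᵥ (QT *ᵥ ξ T) := euclNorm_mulVec_sq hQTh.1 hQTh.2 _
    rw [hηT, add_mulVec, dotProduct_add]
    linarith
  have hfin : N ^ 2 ≤ (Real.sqrt T * P * a * (1 + σ) + σ) * N ^ 2 := by
    have h1 := mul_le_mul_of_nonneg_left hJ hc0
    have h2 : c * (Real.sqrt T * N) = Real.sqrt T * P * a * (1 + σ) * N ^ 2 := by
      rw [hc]; ring
    have h3 : σ * N ^ 2 = σ * qT ^ 2 + σ * I := by rw [hN2]; ring
    nlinarith
  have hNz : N = 0 := by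
    by_contra hne
    have : 0 < N ^ 2 := by positivity
    nlinarith
  have hIz : I = 0 := by
    have : qT ^ 2 + I = 0 := by rw [← hN2, hNz]; simp
    linarith [sq_nonneg qT]
  intro t ht
  constructor
  · have hqt : q t ^ 2 = 0 := by
      by_contra hne
      have hpos : 0 < I := integral_pos hT (hqc.pow 2) (fun s _ => sq_nonneg _)
        ⟨t, ht, lt_of_le_of_ne (sq_nonneg _) (Ne.symm hne)⟩
      exact hpos.ne' hIz
    by_contra hne
    have hpos := (hQ t ht).dotProduct_mulVec_pos hne
    rw [star_trivial, ← hq2 t ht, hqt] at hpos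
    exact lt_irrefl _ hpos
  · have h0 : euclNorm (η t) = 0 :=
      le_antisymm ((hηle t ht).trans (by rw [hNz, mul_zero])) (euclNorm_nonneg _)
    rw [← dotProduct_self_eq_zero, ← euclNorm_sq, h0]
    norm_num

end Uniqueness

section BoundaryValueProblem

variable {n : ℕ} {T : ℝ}

/-- Global solvability of the initial value problem for a linear `2 × 2` block system. -/
lemma exists_block_solution (hT : 0 ≤ T) {F M G H : ℝ → Matrix (Fin n) (Fin n) ℝ}
    (hF : ContinuousOn F (Icc 0 T)) (hM : ContinuousOn M (Icc 0 T))
    (hG : ContinuousOn G (Icc 0 T)) (hH : ContinuousOn H (Icc 0 T)) (x₀ y₀ : Fin n → ℝ) :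
    ∃ ξ η : ℝ → Fin n → ℝ, ξ 0 = x₀ ∧ η 0 = y₀ ∧
      (∀ t ∈ Icc 0 T, HasDerivWithinAt ξ (F t *ᵥ ξ t - M t *ᵥ η t) (Icc 0 T) t) ∧
      (∀ t ∈ Icc 0 T, HasDerivWithinAt η (-(G t *ᵥ ξ t + H t *ᵥ η t)) (Icc 0 T) t) := by
  set B : ℝ → Matrix (Fin n ⊕ Fin n) (Fin n ⊕ Fin n) ℝ :=
    fun t => fromBlocks (F t) (-M t) (-G t) (-H t) with hB
  have hBc : ContinuousOn B (Icc 0 T) := by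
    rw [continuousOn_iff_continuous_domRestrict] at *
    exact Continuous.matrix_fromBlocks hF hM.neg hG.neg hH.neg
  let ℓ : Matrix (Fin n ⊕ Fin n) (Fin n ⊕ Fin n) ℝ →ₗ[ℝ]
      ((Fin n ⊕ Fin n → ℝ) →L[ℝ] (Fin n ⊕ Fin n → ℝ)) :=
    LinearMap.toContinuousLinearMap.toLinearMap ∘ₗ (Matrix.toLin' (R := ℝ)).toLinearMap
  have hℓ : Continuous ℓ := LinearMap.continuous_of_finiteDimensional ℓ
  obtain ⟨α, hα0, hα⟩ := exists_hasDerivWithinAt_linear hT (L := fun t => ℓ (B t))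
    (hℓ.comp_continuousOn hBc) (Sum.elim x₀ y₀)
  have hα' : ∀ t ∈ Icc 0 T, HasDerivWithinAt α (B t *ᵥ α t) (Icc 0 T) t := hα
  refine ⟨fun t i => α t (Sum.inl i), fun t i => α t (Sum.inr i), ?_, ?_, fun t ht => ?_,
    fun t ht => ?_⟩
  · funext i; simp [hα0]
  · funext i; simp [hα0]
  · rw [hasDerivWithinAt_pi]
    intro i
    have h := hasDerivWithinAt_pi.1 (hα' t ht) (Sum.inl i)
    refine h.congr_deriv ?_
    rw [hB, fromBlocks_mulVec, neg_mulVec, ← sub_eq_add_neg]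
    rfl
  · rw [hasDerivWithinAt_pi]
    intro i
    have h := hasDerivWithinAt_pi.1 (hα' t ht) (Sum.inr i)
    refine h.congr_deriv ?_
    rw [hB, fromBlocks_mulVec, neg_mulVec, neg_mulVec, neg_mulVec, ← neg_add]
    rfl

/-- A linear two-point boundary value problem is solvable as soon as the homogeneous one has only
the trivial solution. -/
lemma exists_boundary_solution (hT : 0 ≤ T) {F M G H : ℝ → Matrix (Fin n) (Fin n) ℝ}
    (hF : ContinuousOn F (Icc 0 T)) (hM : ContinuousOn M (Icc 0 T))
    (hG : ContinuousOn G (Icc 0 T)) (hH : ContinuousOn H (Icc 0 T))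
    (Γ : Matrix (Fin n) (Fin n) ℝ)
    (hom : ∀ ξ η : ℝ → Fin n → ℝ,
      (∀ t ∈ Icc 0 T, HasDerivWithinAt ξ (F t *ᵥ ξ t - M t *ᵥ η t) (Icc 0 T) t) →
      (∀ t ∈ Icc 0 T, HasDerivWithinAt η (-(G t *ᵥ ξ t + H t *ᵥ η t)) (Icc 0 T) t) →
      ξ 0 = 0 → η T = Γ *ᵥ ξ T → η 0 = 0)
    (x₀ : Fin n → ℝ) :
    ∃ ξ η : ℝ → Fin n → ℝ,
      (∀ t ∈ Icc 0 T, HasDerivWithinAt ξ (F t *ᵥ ξ t - M t *ᵥ η t) (Icc 0 T) t) ∧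
      (∀ t ∈ Icc 0 T, HasDerivWithinAt η (-(G t *ᵥ ξ t + H t *ᵥ η t)) (Icc 0 T) t) ∧
      ξ 0 = x₀ ∧ η T = Γ *ᵥ ξ T := by
  obtain ⟨ξ₀, η₀, hξ₀, hη₀, hdξ₀, hdη₀⟩ := exists_block_solution hT hF hM hG hH x₀ 0
  choose u v hu hv hdu hdv using fun j : Fin n =>
    exists_block_solution hT hF hM hG hH 0 (Pi.single j (1 : ℝ))
  set U : (Fin n → ℝ) → ℝ → Fin n → ℝ := fun y t => ∑ j, y j • u j t with hU
  set V : (Fin n → ℝ) → ℝ → Fin n → ℝ := fun y t => ∑ j, y j • v j t with hV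
  have hUd : ∀ y, ∀ t ∈ Icc 0 T,
      HasDerivWithinAt (U y) (F t *ᵥ U y t - M t *ᵥ V y t) (Icc 0 T) t := by
    intro y t ht
    have h := HasDerivWithinAt.fun_sum (u := Finset.univ) fun j (_ : j ∈ Finset.univ) =>
      (hdu j t ht).const_smul (y j)
    refine h.congr_deriv ?_
    simp only [hU, hV, mulVec_sum, mulVec_smul, smul_sub, Finset.sum_sub_distrib]
  have hVd : ∀ y, ∀ t ∈ Icc 0 T,
      HasDerivWithinAt (V y) (-(G t *ᵥ U y t + H t *ᵥ V y t)) (Icc 0 T) t := by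
    intro y t ht
    have h := HasDerivWithinAt.fun_sum (u := Finset.univ) fun j (_ : j ∈ Finset.univ) =>
      (hdv j t ht).const_smul (y j)
    refine h.congr_deriv ?_
    simp only [hU, hV, mulVec_sum, mulVec_smul, smul_neg, smul_add, Finset.sum_add_distrib,
      Finset.sum_neg_distrib]
  have hU0 : ∀ y, U y 0 = 0 := fun y => by simp [hU, hu]
  have hV0 : ∀ y, V y 0 = y := fun y => by
    simp only [hV, hv]
    funext i
    simp [Finset.sum_apply, Pi.single_apply]
  let g : (Fin n → ℝ) →ₗ[ℝ] (Fin n → ℝ) :=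
    Fintype.linearCombination ℝ fun j => v j T - Γ *ᵥ u j T
  have hg : ∀ y, g y = V y T - Γ *ᵥ U y T := fun y => by
    simp only [g, Fintype.linearCombination_apply, hU, hV, mulVec_sum, mulVec_smul, smul_sub,
      Finset.sum_sub_distrib]
  have hinj : Function.Injective g := by
    rw [← LinearMap.ker_eq_bot, LinearMap.ker_eq_bot']
    intro y hy
    rw [← hV0 y]
    exact hom (U y) (V y) (hUd y) (hVd y) (hU0 y) (sub_eq_zero.1 ((hg y).symm.trans hy))
  obtain ⟨y, hy⟩ := (LinearMap.injective_iff_surjective.1 hinj) (Γ *ᵥ ξ₀ T - η₀ T)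
  refine ⟨fun t => ξ₀ t + U y t, fun t => η₀ t + V y t, fun t ht => ?_, fun t ht => ?_, ?_, ?_⟩
  · refine ((hdξ₀ t ht).add (hUd y t ht)).congr_deriv ?_
    rw [mulVec_add, mulVec_add]
    abel
  · refine ((hdη₀ t ht).add (hVd y t ht)).congr_deriv ?_
    rw [mulVec_add, mulVec_add]
    abel
  · simp [hξ₀, hU0]
  · have h := (hg y).symm.trans hy
    simp only [mulVec_add]
    rw [sub_eq_iff_eq_add] at h
    rw [h]
    abel

end BoundaryValueProblem

/-- Theorem 3.4: if `⦀Ā⦀_T < ∞`, `⦀𝒮⦀_T < ∞` and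
`√T ⦀φ⦀_T ⦀Ā⦀_T (1 + ⦀𝒮⦀_T) + ⦀𝒮⦀_T < 1`, then (NewRic) has a unique solution
for every initial datum. -/
theorem exists_unique_newRic_of_norm_condition
    (n m : ℕ) (T : ℝ) (hT : 0 < T)
    (A Abar S Q Qbar : ℝ → Matrix (Fin n) (Fin n) ℝ)
    (B : ℝ → Matrix (Fin n) (Fin m) ℝ)
    (R : ℝ → Matrix (Fin m) (Fin m) ℝ)
    (QT QbarT ST : Matrix (Fin n) (Fin n) ℝ)
    (hAc : ContinuousOn A (Set.Icc 0 T)) (hAbarc : ContinuousOn Abar (Set.Icc 0 T))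
    (hBc : ContinuousOn B (Set.Icc 0 T)) (hSc : ContinuousOn S (Set.Icc 0 T))
    (hQc : ContinuousOn Q (Set.Icc 0 T)) (hQbarc : ContinuousOn Qbar (Set.Icc 0 T))
    (hRc : ContinuousOn R (Set.Icc 0 T))
    (hQ : ∀ t ∈ Set.Icc (0:ℝ) T, (Q t).PosDef)
    (hQbar : ∀ t ∈ Set.Icc (0:ℝ) T, (Qbar t).PosSemidef)
    (hR : ∀ t ∈ Set.Icc (0:ℝ) T, (R t).PosDef)
    (δ : ℝ) (hδ : 0 < δ)
    (hRδ : ∀ t ∈ Set.Icc (0:ℝ) T,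
      (R t - δ • (1 : Matrix (Fin m) (Fin m) ℝ)).PosSemidef)
    (hQT : QT.PosDef) (hQbarT : QbarT.PosSemidef)
    -- `Qh t` is the positive semidefinite square root of `Q t`, `QTh` that of `Q_T`
    (Qh : ℝ → Matrix (Fin n) (Fin n) ℝ) (QTh : Matrix (Fin n) (Fin n) ℝ)
    (hQh : ∀ t ∈ Set.Icc (0:ℝ) T, (Qh t).PosSemidef ∧ Qh t * Qh t = Q t)
    (hQTh : QTh.PosSemidef ∧ QTh * QTh = QT)
    -- `φ` is the fundamental solution associated with `A`
    (φ : ℝ → ℝ → Matrix (Fin n) (Fin n) ℝ)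
    (hφ : ∀ s ∈ Set.Icc (0:ℝ) T, φ s s = 1 ∧
      ∀ t ∈ Set.Icc (0:ℝ) T,
        HasDerivWithinAt (fun τ => φ τ s) (A t * φ t s) (Set.Icc (0:ℝ) T) t)
    -- `⦀Ā⦀_T < ∞` and `⦀𝒮⦀_T < ∞`
    (hAbarFin : BddAbove (Set.range fun t : Set.Ioo (0:ℝ) T =>
        opN (Abar t.1 * (Qh t.1)⁻¹)))
    (hSFin : BddAbove (Set.range fun t : Set.Ioo (0:ℝ) T =>
        opN ((Qh t.1)⁻¹ * (Qbar t.1 * (1 - S t.1)) * (Qh t.1)⁻¹)))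
    (hcond : Real.sqrt T * phiNorm T φ Qh QTh * abarNorm T Abar Qh
          * (1 + sNorm T S Qbar Qh ST QbarT QTh)
          + sNorm T S Qbar Qh ST QbarT QTh < 1)
    (x₀ : Fin n → ℝ) :
    (∃ ξ η : ℝ → Fin n → ℝ,
        IsNewRicSol n m T A Abar S Q Qbar B R QT QbarT ST x₀ ξ η) ∧
    (∀ ξ₁ η₁ ξ₂ η₂ : ℝ → Fin n → ℝ,
        IsNewRicSol n m T A Abar S Q Qbar B R QT QbarT ST x₀ ξ₁ η₁ →
        IsNewRicSol n m T A Abar S Q Qbar B R QT QbarT ST x₀ ξ₂ η₂ →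
        ∀ t ∈ Set.Icc (0:ℝ) T, ξ₁ t = ξ₂ t ∧ η₁ t = η₂ t) := by
  have hWc : ContinuousOn (fun t => Qbar t * (1 - S t)) (Icc 0 T) :=
    hQbarc.matrix_mul (continuousOn_const.sub hSc)
  have hMc : ContinuousOn (fun t => B t * (R t)⁻¹ * (B t)ᵀ) (Icc 0 T) :=
    (hBc.matrix_mul (hRc.matrix_inv fun t ht => (hR t ht).det_pos.ne')).matrix_mul
      hBc.matrix_transpose
  have hM : ∀ t ∈ Icc (0:ℝ) T, ∀ v, 0 ≤ v ⬝ᵥ ((B t * (R t)⁻¹ * (B t)ᵀ) *ᵥ v) := by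
    intro t ht v
    have h := (hR t ht).inv.posSemidef.dotProduct_mulVec_nonneg ((B t)ᵀ *ᵥ v)
    rw [star_trivial] at h
    rw [← mulVec_mulVec, ← mulVec_mulVec, dotProduct_mulVec, ← mulVec_transpose]
    exact h
  have hsymm : ∀ t ∈ Icc (0:ℝ) T, (Qh t)ᵀ = Qh t ∧ Qh t * Qh t = Q t := fun t ht =>
    ⟨(conjTranspose_eq_transpose_of_trivial _).symm.trans (hQh t ht).1.isHermitian, (hQh t ht).2⟩
  have hsymmT : QThᵀ = QTh ∧ QTh * QTh = QT :=
    ⟨(conjTranspose_eq_transpose_of_trivial _).symm.trans hQTh.1.isHermitian, hQTh.2⟩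
  have hdet : ∀ {X Y : Matrix (Fin n) (Fin n) ℝ}, Y.PosDef → X * X = Y → IsUnit X.det := by
    intro X Y hY hX
    refine isUnit_iff_ne_zero.2 fun h => hY.det_pos.ne' ?_
    rw [← hX, det_mul, h, zero_mul]
  have hbdd := bddAbove_range_phiNorm hAc hQc hsymm QTh hφ
  have hom : ∀ ξ η : ℝ → Fin n → ℝ,
      (∀ t ∈ Icc (0:ℝ) T, HasDerivWithinAt ξ
        ((A t + Abar t) *ᵥ ξ t - (B t * (R t)⁻¹ * (B t)ᵀ) *ᵥ η t) (Icc (0:ℝ) T) t) →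
      (∀ t ∈ Icc (0:ℝ) T, HasDerivWithinAt η
        (-((Q t + Qbar t * (1 - S t)) *ᵥ ξ t + (A t)ᵀ *ᵥ η t)) (Icc (0:ℝ) T) t) →
      ξ 0 = 0 → η T = (QT + QbarT * (1 - ST)) *ᵥ ξ T →
      ∀ t ∈ Icc (0:ℝ) T, ξ t = 0 ∧ η t = 0 := by
    intro ξ η hξ hη hξ0 hηT
    exact homogeneous_eq_zero hT hAbarc hQc hWc hMc hQ hM hsymm
      (fun t ht => hdet (hQ t ht) (hQh t ht).2) hsymmT (hdet hQT hQTh.2) hφ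
      (Real.iSup_nonneg fun _ => opN_nonneg _) ((opN_nonneg _).trans (le_max_right _ _))
      (fun t ht => le_ciSup hbdd ⟨t, ht⟩) (fun t ht => le_ciSup hAbarFin ⟨t, ht⟩)
      (fun t ht => (le_ciSup hSFin ⟨t, ht⟩).trans (le_max_left _ _)) (le_max_right _ _)
      hcond hξ hη hξ0 hηT
  refine ⟨?_, ?_⟩
  · obtain ⟨ξ, η, hξ, hη, hξ0, hηT⟩ := exists_boundary_solution hT.le
      (F := fun t => A t + Abar t) (hAc.add hAbarc) hMc (G := fun t => Q t + Qbar t * (1 - S t))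
      (hQc.add hWc) (hAc.matrix_transpose)
      (QT + QbarT * (1 - ST)) (fun ξ η hξ hη hξ0 hηT =>
        (hom ξ η hξ hη hξ0 hηT 0 ⟨le_rfl, hT.le⟩).2) x₀
    exact ⟨ξ, η, hξ, hξ0, hη, hηT⟩
  · rintro ξ₁ η₁ ξ₂ η₂ ⟨hξ₁, hξ₁0, hη₁, hη₁T⟩ ⟨hξ₂, hξ₂0, hη₂, hη₂T⟩ t ht
    have h := hom (fun s => ξ₁ s - ξ₂ s) (fun s => η₁ s - η₂ s)
      (fun s hs => ((hξ₁ s hs).sub (hξ₂ s hs)).congr_deriv ?_)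
      (fun s hs => ((hη₁ s hs).sub (hη₂ s hs)).congr_deriv ?_)
      (by rw [hξ₁0, hξ₂0, sub_self]) (by rw [hη₁T, hη₂T, mulVec_sub]) t ht
    · exact ⟨sub_eq_zero.1 h.1, sub_eq_zero.1 h.2⟩
    · rw [mulVec_sub, mulVec_sub]
      abel
    · rw [mulVec_sub, mulVec_sub]
      abel

end
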